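/- Let f : [0,1] → ℝ, let K ≥ 2 and N ≥ 1 be integers, and let T be the quantized tensor representation of f on D_K. Define the matrix product state S := A_L A^{K−2} A_R, i.e. S(σ_{1:K}) := Σ_{α_1,…,α_{K−1} ∈ {0,…,N}} A_L^{1,α_1}(σ_1) A^{α_1 α_2}(σ_2) ⋯ A^{α_{K−2} α_{K−1}}(σ_{K−1}) A_R^{α_{K−1},1}(σ_K). Then max_{σ_{1:K} ∈ {0,1}^K} |S(σ_{1:K}) − T(σ_{1:K})| ≤ E_{1,N}[f]. -/

import Mathlib

noncomputable section

/-- The Chebyshev–Lobatto node `c_N^α = (cos(πα/N)+1)/2`, shifted and scaled to `[0,1]`. -/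
def chebNode (N α : ℕ) : ℝ := (Real.cos (Real.pi * α / N) + 1) / 2

/-- The Lagrange cardinal polynomial `P_N^α` for the Chebyshev–Lobatto grid. -/
def chebP (N α : ℕ) (x : ℝ) : ℝ :=
  ∏ β ∈ (Finset.range (N + 1)).erase α,
    (x - chebNode N β) / (chebNode N α - chebNode N β)

/-- The real value of a bit. -/
def bitVal (b : Bool) : ℝ := if b then 1 else 0

/-- The quantized tensor representation of `f` on the dyadic grid `D_K`. -/
def qtt (f : ℝ → ℝ) (K : ℕ) (σ : Fin K → Bool) : ℝ :=
  f (∑ k : Fin K, (2 : ℝ) ^ (-(k.val + 1 : ℤ)) * bitVal (σ k))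

/-- The repeated contraction `A^p` of the Chebyshev interpolating core
`A^{αβ}(σ) = P_N^α((σ + c_N^β)/2)`, with the convention `A^0 = Id`. -/
def Apow (N : ℕ) : (p : ℕ) → (Fin p → Bool) → ℕ → ℕ → ℝ
  | 0, _, α, β => if α = β then 1 else 0
  | p + 1, σ, α, β => ∑ γ ∈ Finset.range (N + 1),
      Apow N p (fun i => σ i.castSucc) α γ *
        chebP N γ ((bitVal (σ (Fin.last p)) + chebNode N β) / 2)

open Polynomial in
/-- The cardinal function `chebP` is the evaluation of Mathlib's Lagrange basis polynomial. -/
lemma chebP_eq_eval_basis (N α : ℕ) (x : ℝ) :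
    chebP N α x = (Lagrange.basis (Finset.range (N + 1)) (chebNode N) α).eval x := by
  simp [chebP, Lagrange.basis, Lagrange.basisDivisor, eval_prod, div_eq_inv_mul]

lemma chebNode_injOn {N : ℕ} (hN : 1 ≤ N) :
    Set.InjOn (chebNode N) (Finset.range (N + 1) : Set ℕ) := by
  have hN' : (0 : ℝ) < N := by exact_mod_cast hN
  have mem : ∀ a ∈ (Finset.range (N + 1) : Set ℕ),
      Real.pi * a / N ∈ Set.Icc (0 : ℝ) Real.pi := by
    intro a ha
    have ha' : (a : ℝ) ≤ N := by
      have : a ≤ N := by simpa [Nat.lt_succ_iff] using ha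
      exact_mod_cast this
    refine ⟨by positivity, ?_⟩
    rw [div_le_iff₀ hN']
    exact mul_le_mul_of_nonneg_left ha' Real.pi_pos.le
  intro a ha b hb hab
  have hcos : Real.cos (Real.pi * a / N) = Real.cos (Real.pi * b / N) := by
    simp only [chebNode] at hab
    linarith
  have h := Real.injOn_cos (mem a ha) (mem b hb) hcos
  have hpi := Real.pi_ne_zero
  field_simp at h
  exact_mod_cast h

lemma chebP_chebNode {N α β : ℕ} (hN : 1 ≤ N) (hα : α ∈ Finset.range (N + 1))
    (hβ : β ∈ Finset.range (N + 1)) :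
    chebP N α (chebNode N β) = if α = β then 1 else 0 := by
  rw [chebP_eq_eval_basis]
  split_ifs with h
  · subst h
    exact Lagrange.eval_basis_self (chebNode_injOn hN) hα
  · exact Lagrange.eval_basis_of_ne h hβ

open Polynomial in
/-- Chebyshev–Lobatto interpolation is exact on polynomials of degree at most `N`. -/
lemma sum_eval_chebNode_mul_chebP {N : ℕ} (hN : 1 ≤ N) {q : ℝ[X]} (hq : q.natDegree ≤ N)
    (y : ℝ) :
    ∑ γ ∈ Finset.range (N + 1), q.eval (chebNode N γ) * chebP N γ y = q.eval y := by
  have hdeg : q.degree < (Finset.range (N + 1)).card := by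
    rw [Finset.card_range]
    exact lt_of_le_of_lt (natDegree_le_iff_degree_le.mp hq) (by exact_mod_cast Nat.lt_succ_self N)
  conv_rhs => rw [Lagrange.eq_interpolate (chebNode_injOn hN) hdeg]
  simp [Lagrange.interpolate_apply, eval_finsetSum, chebP_eq_eval_basis]

open Polynomial in
lemma sum_chebP_affine_mul_chebP {N α : ℕ} (hN : 1 ≤ N) (hα : α ∈ Finset.range (N + 1))
    (a b y : ℝ) :
    ∑ γ ∈ Finset.range (N + 1), chebP N α (a + b * chebNode N γ) * chebP N γ y =
      chebP N α (a + b * y) := by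
  have hq : ((Lagrange.basis (Finset.range (N + 1)) (chebNode N) α).comp
      (C a + C b * X)).natDegree ≤ N := by
    refine natDegree_comp_le.trans ?_
    have h₁ : (Lagrange.basis (Finset.range (N + 1)) (chebNode N) α).natDegree = N := by
      refine natDegree_eq_of_degree_eq_some ?_
      rw [Lagrange.degree_basis (chebNode_injOn hN) hα]
      simp
    have h₂ : (C a + C b * X : ℝ[X]).natDegree ≤ 1 := by
      rw [add_comm]
      exact natDegree_linear_le
    rw [h₁]
    exact (Nat.mul_le_mul_left N h₂).trans_eq (mul_one N)
  simpa [chebP_eq_eval_basis] using sum_eval_chebNode_mul_chebP hN hq y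

/-- The real number in `[0,1]` with binary digits `σ`. -/
def binaryValue (p : ℕ) (σ : Fin p → Bool) : ℝ :=
  ∑ k : Fin p, (2 : ℝ) ^ (-(k.val + 1 : ℤ)) * bitVal (σ k)

lemma two_zpow_neg_succ (n : ℕ) : (2 : ℝ) ^ (-(n + 1 : ℤ)) = (1 / 2) ^ n / 2 := by
  rw [zpow_neg, one_div, inv_pow]
  norm_cast
  rw [pow_succ]
  push_cast
  rw [mul_inv, div_eq_mul_inv]

lemma bitVal_nonneg (b : Bool) : 0 ≤ bitVal b := by
  cases b <;> simp [bitVal]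

lemma bitVal_le_one (b : Bool) : bitVal b ≤ 1 := by
  cases b <;> simp [bitVal]

lemma binaryValue_castSucc (p : ℕ) (σ : Fin (p + 1) → Bool) :
    binaryValue (p + 1) σ =
      binaryValue p (fun i => σ i.castSucc) + (1 / 2) ^ p * (bitVal (σ (Fin.last p)) / 2) := by
  simp only [binaryValue, Fin.sum_univ_castSucc, two_zpow_neg_succ, Fin.val_castSucc,
    Fin.val_last]
  ring

lemma binaryValue_succ (p : ℕ) (σ : Fin (p + 1) → Bool) :
    binaryValue (p + 1) σ =
      bitVal (σ 0) / 2 + 1 / 2 * binaryValue p (fun i => σ i.succ) := by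
  simp only [binaryValue, Fin.sum_univ_succ, two_zpow_neg_succ, Fin.val_succ, Fin.val_zero,
    Finset.mul_sum]
  congr 1
  · ring
  · exact Finset.sum_congr rfl fun i _ => by ring

lemma binaryValue_mem_Icc (p : ℕ) (σ : Fin p → Bool) : binaryValue p σ ∈ Set.Icc (0 : ℝ) 1 := by
  induction p with
  | zero => simp [binaryValue]
  | succ p ih =>
    obtain ⟨h₀, h₁⟩ := ih fun i => σ i.succ
    rw [binaryValue_succ]
    constructor <;> linarith [bitVal_nonneg (σ 0), bitVal_le_one (σ 0)]

/-- Contracting `p` interpolating cores samples the cardinal function at the nodes of the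
dyadic subinterval selected by the digits. -/
lemma Apow_eq_chebP {N α β : ℕ} (hN : 1 ≤ N) (hα : α ∈ Finset.range (N + 1))
    (hβ : β ∈ Finset.range (N + 1)) (p : ℕ) (σ : Fin p → Bool) :
    Apow N p σ α β = chebP N α (binaryValue p σ + (1 / 2) ^ p * chebNode N β) := by
  induction p generalizing β with
  | zero => simp [Apow, binaryValue, chebP_chebNode hN hα hβ]
  | succ p ih =>
    rw [Apow, Finset.sum_congr rfl fun γ hγ => by rw [ih hγ],
      sum_chebP_affine_mul_chebP hN hα, binaryValue_castSucc]
    congr 1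
    ring

lemma sum_Apow_mul_chebP {N α : ℕ} (hN : 1 ≤ N) (hα : α ∈ Finset.range (N + 1)) (p : ℕ)
    (σ : Fin (p + 1) → Bool) :
    ∑ β ∈ Finset.range (N + 1), Apow N p (fun i => σ i.castSucc) α β *
        chebP N β (bitVal (σ (Fin.last p)) / 2) = chebP N α (binaryValue (p + 1) σ) := by
  rw [Finset.sum_congr rfl fun β hβ => by rw [Apow_eq_chebP hN hα hβ],
    sum_chebP_affine_mul_chebP hN hα, binaryValue_castSucc]

/-- the matrix product state `S = A_L A^{K-2} A_R` (cores
`A_L^{1,α}(σ) = f((σ+c_N^α)/2)`, `A^{αβ}(σ) = P_N^α((σ+c_N^β)/2)`,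
`A_R^{β,1}(σ) = P_N^β(σ/2)`) satisfies `max_σ |S(σ) - T(σ)| ≤ E_{1,N}[f]`, expressed via
an arbitrary upper bound `E1` for the interpolation error at level `m = 1`. -/
theorem stmt9 (f : ℝ → ℝ) (K N : ℕ) (hK : 2 ≤ K) (hN : 1 ≤ N) (E1 : ℝ)
    (hE : ∀ u ∈ Set.Icc (0 : ℝ) (1 - (2 : ℝ) ^ (-(1 : ℤ))), ∀ v ∈ Set.Icc (0 : ℝ) 1,
      |f (u + (2 : ℝ) ^ (-(1 : ℤ)) * v) -
        ∑ α ∈ Finset.range (N + 1),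
          f (u + (2 : ℝ) ^ (-(1 : ℤ)) * chebNode N α) * chebP N α v| ≤ E1) :
    ∀ σ : Fin K → Bool,
      |(∑ α ∈ Finset.range (N + 1), ∑ β ∈ Finset.range (N + 1),
          f ((bitVal (σ ⟨0, by omega⟩) + chebNode N α) / 2) *
            Apow N (K - 2) (fun i => σ ⟨i.val + 1, by have := i.isLt; omega⟩) α β *
            chebP N β (bitVal (σ ⟨K - 1, by omega⟩) / 2)) -
        qtt f K σ| ≤ E1 := by
  obtain ⟨n, rfl⟩ := Nat.exists_eq_add_of_le' hK
  intro σ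
  have hbit := bitVal_le_one (σ 0)
  have key := hE (bitVal (σ 0) / 2)
    ⟨by linarith [bitVal_nonneg (σ 0)], by rw [zpow_neg_one]; linarith⟩
    (binaryValue (n + 1) fun i => σ i.succ) (binaryValue_mem_Icc _ _)
  have hT : qtt f (n + 2) σ =
      f (bitVal (σ 0) / 2 + (2 : ℝ) ^ (-(1 : ℤ)) * binaryValue (n + 1) fun i => σ i.succ) := by
    rw [zpow_neg_one, ← one_div, ← binaryValue_succ]
    rfl
  rw [hT, abs_sub_comm]
  convert key using 3
  refine Finset.sum_congr rfl fun α hα => ?_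
  rw [← sum_Apow_mul_chebP hN hα, Finset.mul_sum]
  refine Finset.sum_congr rfl fun β _ => ?_
  rw [mul_assoc]
  congr 2
  rw [zpow_neg_one]
  change (bitVal (σ 0) + chebNode N α) / 2 = _
  ring
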